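/- arXiv:2004.07354 — 2 statements merged into one kernel-verified Lean document; each statement's English description precedes it below -/
import Mathlib

section
/- Let S be an HV-convex polyomino and let p, q, s ∈ ℤ² be such that p + s ∈ S, q + s ∈ S, p ≠ q, and both coordinates of p are less than or equal to the corresponding coordinates of q. Then p + s + (1,0) ∈ S or p + s + (0,1) ∈ S. -/
/-- Two lattice points are 4-adjacent if their Euclidean distance is 1. -/
def Adj (p q : ℤ × ℤ) : Prop := (p.1 - q.1) ^ 2 + (p.2 - q.2) ^ 2 = 1

/-- A polyomino is a finite nonempty subset of ℤ² any two of whose points are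
joined by a 4-connected path (a sequence of distinct points, consecutive ones at
distance 1) lying entirely in the set. -/
def IsPolyomino (S : Set (ℤ × ℤ)) : Prop :=
  S.Finite ∧ S.Nonempty ∧
    ∀ p ∈ S, ∀ q ∈ S, ∃ l : List (ℤ × ℤ),
      l.Nodup ∧ l.Chain' Adj ∧ l.head? = some p ∧ l.getLast? = some q ∧
      ∀ z ∈ l, z ∈ S

/-- A set S ⊆ ℤ² is HV-convex if its intersection with every horizontal and
every vertical line is a set of consecutive lattice points. -/
def HVConvex (S : Set (ℤ × ℤ)) : Prop :=
  (∀ x x'' x' y : ℤ, (x, y) ∈ S → (x', y) ∈ S → x ≤ x'' → x'' ≤ x' → (x'', y) ∈ S) ∧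
  (∀ x y y'' y' : ℤ, (x, y) ∈ S → (x, y') ∈ S → y ≤ y'' → y'' ≤ y' → (x, y'') ∈ S)

/-- Two 4-adjacent points agree in one coordinate and differ by one in the other. -/
theorem Adj.coord_cases {p q : ℤ × ℤ} (h : Adj p q) :
    (p.1 = q.1 ∧ (p.2 = q.2 + 1 ∨ q.2 = p.2 + 1)) ∨
      (p.2 = q.2 ∧ (p.1 = q.1 + 1 ∨ q.1 = p.1 + 1)) := by
  unfold Adj at h
  have hx₁ : p.1 - q.1 ≤ 1 := by nlinarith [sq_nonneg (p.2 - q.2)]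
  have hx₂ : -1 ≤ p.1 - q.1 := by nlinarith [sq_nonneg (p.2 - q.2)]
  have hy₁ : p.2 - q.2 ≤ 1 := by nlinarith [sq_nonneg (p.1 - q.1)]
  have hy₂ : -1 ≤ p.2 - q.2 := by nlinarith [sq_nonneg (p.1 - q.1)]
  obtain hx | hx | hx : p.1 - q.1 = -1 ∨ p.1 - q.1 = 0 ∨ p.1 - q.1 = 1 := by omega
  all_goals
    obtain hy | hy | hy : p.2 - q.2 = -1 ∨ p.2 - q.2 = 0 ∨ p.2 - q.2 = 1 := by omega
    all_goals
      rw [hx, hy] at h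
      omega

/-- A 4-connected path in `S` that starts in the open quadrant at `a` stays there if `S` misses
the two open boundary rays of the quadrant. -/
theorem mem_quadrant_of_isChain_adj {S : Set (ℤ × ℤ)} {a : ℤ × ℤ}
    (hright : ∀ x, a.1 < x → (x, a.2) ∉ S) (hup : ∀ y, a.2 < y → (a.1, y) ∉ S)
    (l : List (ℤ × ℤ)) (b : ℤ × ℤ) (hb : a.1 < b.1 ∧ a.2 < b.2)
    (hl : (b :: l).IsChain Adj) (hS : ∀ z ∈ b :: l, z ∈ S) :
    ∀ z ∈ b :: l, a.1 < z.1 ∧ a.2 < z.2 := by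
  induction l generalizing b with
  | nil => simpa using hb
  | cons c l ih =>
    rw [List.isChain_cons_cons] at hl
    have hcS : (c.1, c.2) ∈ S := hS c (by simp)
    have hc₁ : c.1 = a.1 → ¬ a.2 < c.2 := fun h h' => hup _ h' (h ▸ hcS)
    have hc₂ : c.2 = a.2 → ¬ a.1 < c.1 := fun h h' => hright _ h' (h ▸ hcS)
    have hc : a.1 < c.1 ∧ a.2 < c.2 := by
      have := hl.1.coord_cases
      omega
    intro z hz
    rcases List.mem_cons.1 hz with rfl | hz
    · exact hb
    · exact ih c hc hl.2 (fun w hw => hS w (List.mem_cons_of_mem _ hw)) z hz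

theorem hv_convex_polyomino_shifted_staircase
    (S : Set (ℤ × ℤ)) (hpoly : IsPolyomino S) (hhv : HVConvex S)
    (p q s : ℤ × ℤ) (hps : p + s ∈ S) (hqs : q + s ∈ S) (hpq : p ≠ q)
    (h1 : p.1 ≤ q.1) (h2 : p.2 ≤ q.2) :
    p + s + (1, 0) ∈ S ∨ p + s + (0, 1) ∈ S := by
  by_contra! hcon
  obtain ⟨hr, hu⟩ := hcon
  obtain ⟨-, -, hconn⟩ := hpoly
  have hright : ∀ x, (p + s).1 < x → (x, (p + s).2) ∉ S := fun x hx hxS =>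
    hr (by simpa [Prod.add_def] using
      hhv.1 (p + s).1 ((p + s).1 + 1) x (p + s).2 hps hxS (by omega) hx)
  have hup : ∀ y, (p + s).2 < y → ((p + s).1, y) ∉ S := fun y hy hyS =>
    hu (by simpa [Prod.add_def] using
      hhv.2 (p + s).1 (p + s).2 ((p + s).2 + 1) y hps hyS (by omega) hy)
  have hq : (p + s).1 < (q + s).1 ∧ (p + s).2 < (q + s).2 := by
    have hqs' : ((q + s).1, (q + s).2) ∈ S := hqs
    have hx : p.1 ≠ q.1 := fun h => by
      have hy : p.2 ≠ q.2 := fun h' => hpq (Prod.ext h h')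
      refine hup (q + s).2 (by simp only [Prod.snd_add]; omega) ?_
      rwa [show (p + s).1 = (q + s).1 by simp [h]]
    have hy : p.2 ≠ q.2 := fun h => by
      refine hright (q + s).1 (by simp only [Prod.fst_add]; omega) ?_
      rwa [show (p + s).2 = (q + s).2 by simp [h]]
    simp only [Prod.fst_add, Prod.snd_add]
    omega
  obtain ⟨l, -, hchain, hhead, hlast, hlS⟩ := hconn _ hqs _ hps
  obtain ⟨t, rfl⟩ := List.head?_eq_some_iff.1 hhead
  have := mem_quadrant_of_isChain_adj hright hup t _ hq hchain hlS _ (List.mem_of_getLast? hlast)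
  exact lt_irrefl _ this.1
end

section
/- For any finite nonempty digital convex set S ⊆ ℤ² of n points, one has n ≥ (1/4)·w(S)², where w(S) is the lattice width of S. -/
/-- The canonical embedding of ℤ² into ℝ². -/
def toR2 (z : ℤ × ℤ) : ℝ × ℝ := ((z.1 : ℝ), (z.2 : ℝ))

/-- A set S ⊆ ℤ² is digital convex if conv(S) ∩ ℤ² = S. -/
def DigitalConvex (S : Set (ℤ × ℤ)) : Prop :=
  {z : ℤ × ℤ | toR2 z ∈ convexHull ℝ (toR2 '' S)} = S

/-- The lattice width of S: the minimum over nonzero u ∈ ℤ² of the maximum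
over a, b ∈ S of u·(b − a). -/
noncomputable def latticeWidth (S : Set (ℤ × ℤ)) : ℤ :=
  sInf {w : ℤ | ∃ u : ℤ × ℤ, u ≠ 0 ∧
    w = sSup {d : ℤ | ∃ a ∈ S, ∃ b ∈ S,
      d = u.1 * (b.1 - a.1) + u.2 * (b.2 - a.2)}}

/-- The lattice diameter of S: the maximum, over all lines in ℝ², of the number
of points of S lying on the line, minus 1. -/
noncomputable def latticeDiameter (S : Set (ℤ × ℤ)) : ℤ :=
  ((sSup {m : ℕ | ∃ a v : ℝ × ℝ, v ≠ 0 ∧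
    m = Set.ncard {z ∈ S | ∃ t : ℝ, toR2 z = a + t • v}} : ℕ) : ℤ) - 1

/-- A finite set of lattice points containing every lattice point of each triangle
spanned by three of its elements. -/
def TriClosed (S : Finset (ℤ × ℤ)) : Prop :=
  ∀ a ∈ S, ∀ b ∈ S, ∀ c ∈ S, ∀ p : ℤ × ℤ, ∀ α β γ : ℝ, 0 ≤ α → 0 ≤ β → 0 ≤ γ →
    α + β + γ = 1 → (p.1 : ℝ) = α * a.1 + β * b.1 + γ * c.1 →
    (p.2 : ℝ) = α * a.2 + β * b.2 + γ * c.2 → p ∈ S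

/-- Every nonzero integer functional has width at least `w` on `S`. -/
def WidthGE (S : Finset (ℤ × ℤ)) (w : ℤ) : Prop :=
  ∀ u : ℤ × ℤ, u ≠ 0 → ∃ a ∈ S, ∃ b ∈ S, w ≤ u.1 * (a.1 - b.1) + u.2 * (a.2 - b.2)

/-- The automorphism of `ℤ²` given by an integer matrix of determinant `±1`. -/
def unimodularEquiv (p q r t : ℤ) (h : (p * t - q * r) * (p * t - q * r) = 1) :
    ℤ × ℤ ≃ ℤ × ℤ where
  toFun z := (p * z.1 + q * z.2, r * z.1 + t * z.2)
  invFun z := ((p * t - q * r) * (t * z.1 - q * z.2), (p * t - q * r) * (p * z.2 - r * z.1))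
  left_inv z := by
    ext <;> dsimp
    · linear_combination z.1 * h
    · linear_combination z.2 * h
  right_inv z := by
    ext <;> dsimp
    · linear_combination z.1 * h
    · linear_combination z.2 * h

/-- The preimage of `S` under a unimodular matrix. -/
def unimodularPreimage (S : Finset (ℤ × ℤ)) (p q r t : ℤ)
    (h : (p * t - q * r) * (p * t - q * r) = 1) : Finset (ℤ × ℤ) :=
  S.map (unimodularEquiv p q r t h).symm.toEmbedding

section Unimodular

variable {S : Finset (ℤ × ℤ)} {p q r t : ℤ} (h : (p * t - q * r) * (p * t - q * r) = 1)

theorem mem_unimodularPreimage (z : ℤ × ℤ) : z ∈ unimodularPreimage S p q r t h ↔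
    (p * z.1 + q * z.2, r * z.1 + t * z.2) ∈ S := by
  simp [unimodularPreimage, Finset.mem_map_equiv, unimodularEquiv]

theorem card_unimodularPreimage : (unimodularPreimage S p q r t h).card = S.card := by
  simp [unimodularPreimage]

theorem TriClosed.preimage (hS : TriClosed S) :
    TriClosed (unimodularPreimage S p q r t h) := by
  intro a ha b hb c hc z α β γ hα hβ hγ h1 hx hy
  rw [mem_unimodularPreimage] at *
  refine hS _ ha _ hb _ hc _ α β γ hα hβ hγ h1 ?_ ?_ <;> push_cast <;> rw [hx, hy] <;> ring

theorem WidthGE.preimage {w : ℤ} (hS : WidthGE S w) :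
    WidthGE (unimodularPreimage S p q r t h) w := by
  intro u hu
  obtain ⟨a, ha, b, hb, hab⟩ := hS
    ((p * t - q * r) * (t * u.1 - r * u.2), (p * t - q * r) * (p * u.2 - q * u.1)) (by
      intro h0
      rw [Prod.mk_eq_zero] at h0
      apply hu
      ext
      · dsimp
        linear_combination p * h0.1 + r * h0.2 - u.1 * h
      · dsimp
        linear_combination q * h0.1 + t * h0.2 - u.2 * h)
  refine ⟨(unimodularEquiv p q r t h).symm a, by simpa [unimodularPreimage] using ha,
    (unimodularEquiv p q r t h).symm b, by simpa [unimodularPreimage] using hb, ?_⟩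
  refine hab.trans (le_of_eq ?_)
  dsimp [unimodularEquiv]
  ring

end Unimodular

theorem TriClosed.segment {S : Finset (ℤ × ℤ)} (hS : TriClosed S) {a b : ℤ × ℤ} (ha : a ∈ S)
    (hb : b ∈ S) {k : ℤ} (hy : b.2 = a.2) (h0 : 0 ≤ k) (hk : k ≤ b.1 - a.1) :
    (a.1 + k, a.2) ∈ S := by
  rcases h0.eq_or_lt with rfl | h0
  · simpa using ha
  have hpos : (0 : ℝ) < b.1 - a.1 := by exact_mod_cast h0.trans_le hk
  have hk' : (k : ℝ) ≤ b.1 - a.1 := by exact_mod_cast hk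
  have h0' : (0 : ℝ) < k := by exact_mod_cast h0
  refine hS a ha b hb b hb _ (1 - k / (b.1 - a.1)) (k / (b.1 - a.1)) 0 ?_ (by positivity) le_rfl
    (by ring) ?_ ?_
  · rw [sub_nonneg, div_le_one hpos]
    exact hk'
  · push_cast
    field_simp
    ring
  · rw [hy]
    push_cast
    ring

theorem TriClosed.mem_of_base {S : Finset (ℤ × ℤ)} (hS : TriClosed S) {a t : ℤ × ℤ} {m x i : ℤ}
    (ha : a ∈ S) (hb : (a.1 + m, a.2) ∈ S) (ht : t ∈ S) (hm : 0 < m) (hh : 0 < t.2 - a.2)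
    (hi : 0 ≤ i) (hl : i * (t.1 - a.1) ≤ (t.2 - a.2) * x)
    (hr : (t.2 - a.2) * x ≤ (t.2 - a.2) * m + i * (t.1 - a.1 - m)) :
    (a.1 + x, a.2 + i) ∈ S := by
  have hm' : (0 : ℝ) < m := by exact_mod_cast hm
  have hh' : (0 : ℝ) < t.2 - a.2 := by exact_mod_cast hh
  have hi' : (0 : ℝ) ≤ i := by exact_mod_cast hi
  have hl' : (i : ℝ) * (t.1 - a.1) ≤ (t.2 - a.2) * x := by exact_mod_cast hl
  have hr' : ((t.2 : ℝ) - a.2) * x ≤ (t.2 - a.2) * m + i * (t.1 - a.1 - m) := by exact_mod_cast hr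
  refine hS a ha _ hb t ht _
    (((t.2 - a.2) * m + i * (t.1 - a.1 - m) - (t.2 - a.2) * x) / (m * (t.2 - a.2)))
    (((t.2 - a.2) * x - i * (t.1 - a.1)) / (m * (t.2 - a.2))) (i / (t.2 - a.2))
    (div_nonneg (by linarith) (by positivity)) (div_nonneg (by linarith) (by positivity))
    (by positivity) ?_ ?_ ?_
  · field_simp
    ring
  · push_cast
    field_simp
    ring
  · push_cast
    field_simp
    ring

/-- Twice the number of points above a horizontal base of length `m` is at least
`m * (height - 1)`. -/
theorem TriClosed.card_above {S : Finset (ℤ × ℤ)} (hS : TriClosed S) {a t : ℤ × ℤ} {m : ℤ}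
    (ha : a ∈ S) (hb : (a.1 + m, a.2) ∈ S) (ht : t ∈ S) (hm : 0 ≤ m) :
    m * (t.2 - a.2 - 1) ≤ 2 * ((S.filter fun z => a.2 < z.2).card : ℤ) := by
  rcases le_or_gt (t.2 - a.2) 0 with hh | hh
  · have := mul_nonneg hm (by linarith : 0 ≤ -(t.2 - a.2 - 1))
    linarith [Int.natCast_nonneg (S.filter fun z => a.2 < z.2).card]
  set h := t.2 - a.2 with hdef
  set d := t.1 - a.1 with ddef
  set A := S.filter fun z => a.2 < z.2 with hA
  have hc : ∀ i : ℤ, ∃ c : ℤ, i * d ≤ h * c ∧ h * c < i * d + h := fun i =>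
    ⟨-((-(i * d)) / h), by
      have h1 := Int.emod_add_mul_ediv (-(i * d)) h
      have h2 := Int.emod_nonneg (-(i * d)) hh.ne'
      have h3 := Int.emod_lt_of_pos (-(i * d)) hh
      constructor <;> linarith⟩
  choose c hc1 hc2 using hc
  let f : ℤ × ℤ → ℤ × ℤ := fun z => (a.1 + (c z.1 + z.2), a.2 + z.1)
  let ρ : ℤ × ℤ → ℤ × ℤ := fun z => (2 * a.1 + m + d - z.1, 2 * a.2 + h - z.2)
  have hf : Function.Injective f := by
    rintro ⟨i, k⟩ ⟨j, l⟩ hij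
    simp only [f, Prod.mk.injEq] at hij
    obtain rfl : i = j := by linarith [hij.2]
    ext
    · rfl
    · dsimp
      linarith [hij.1]
  have hsub : (Finset.Ioo 0 h ×ˢ Finset.Ico 0 m).image f ⊆ A ∪ A.image ρ := by
    intro z hz
    obtain ⟨⟨i, k⟩, hik, rfl⟩ := Finset.mem_image.1 hz
    simp only [Finset.mem_product, Finset.mem_Ioo, Finset.mem_Ico] at hik
    obtain ⟨⟨hi0, hih⟩, hk0, hkm⟩ := hik
    have hm' : 0 < m := hk0.trans_lt hkm
    have e1 : i * d ≤ h * (c i + k) := by nlinarith [hc1 i]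
    have e2 : h * (c i + k) ≤ h * m + i * d := by nlinarith [hc2 i]
    rw [Finset.mem_union]
    rcases le_or_gt (h * (c i + k)) (h * m + i * (d - m)) with hle | hgt
    · left
      exact Finset.mem_filter.2 ⟨hS.mem_of_base ha hb ht hm' hh hi0.le e1 hle, by
        simp only [f]; linarith⟩
    · right
      refine Finset.mem_image.2 ⟨(a.1 + (m + d - (c i + k)), a.2 + (h - i)),
        Finset.mem_filter.2 ⟨hS.mem_of_base ha hb ht hm' hh (by linarith) ?_ ?_, by
          dsimp only; linarith⟩, ?_⟩
      · linarith
      · linarith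
      · ext <;> simp only [ρ, f] <;> ring
  have h1 := Finset.card_le_card hsub
  rw [Finset.card_image_of_injective _ hf, Finset.card_product, Int.card_Ioo, Int.card_Ico] at h1
  have h2 := h1.trans ((Finset.card_union_le _ _).trans
    (Nat.add_le_add_left Finset.card_image_le _))
  zify at h2
  rw [Int.toNat_of_nonneg (by linarith), Int.toNat_of_nonneg (by linarith)] at h2
  linarith

theorem TriClosed.card_below {S : Finset (ℤ × ℤ)} (hS : TriClosed S) {a t : ℤ × ℤ} {m : ℤ}
    (ha : a ∈ S) (hb : (a.1 + m, a.2) ∈ S) (ht : t ∈ S) (hm : 0 ≤ m) :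
    m * (a.2 - t.2 - 1) ≤ 2 * ((S.filter fun z => z.2 < a.2).card : ℤ) := by
  have h := (hS.preimage (p := -1) (q := 0) (r := 0) (t := -1) (by norm_num)).card_above
    (a := (-(a.1 + m), -a.2)) (t := (-t.1, -t.2)) (m := m)
    (by rw [mem_unimodularPreimage]; simpa using hb)
    (by rw [mem_unimodularPreimage]; simpa using ha)
    (by rw [mem_unimodularPreimage]; simpa using ht) hm
  have hcard : ((unimodularPreimage S (-1) 0 0 (-1) (by norm_num)).filter
      fun z => -a.2 < z.2).card ≤ (S.filter fun z => z.2 < a.2).card := by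
    refine Finset.card_le_card_of_injOn (fun z => -z) ?_ neg_injective.injOn
    intro z hz
    rw [Finset.mem_coe, Finset.mem_filter, mem_unimodularPreimage] at hz
    rw [Finset.mem_coe, Finset.mem_filter]
    refine ⟨?_, ?_⟩
    · convert hz.1 using 1
      ext <;> simp
    · simp only [Prod.snd_neg]
      linarith [hz.2]
  zify at hcard
  dsimp only at h
  linarith

/-- A horizontal lattice segment of length `m` and vertical extent at least `w` force
at least `m * w / 2 + 1` points. -/
theorem TriClosed.card_ge {S : Finset (ℤ × ℤ)} (hS : TriClosed S) {a t b : ℤ × ℤ} {m w : ℤ}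
    (ha : a ∈ S) (hb : (a.1 + m, a.2) ∈ S) (ht : t ∈ S) (hbot : b ∈ S) (hm : 0 ≤ m)
    (hw : w ≤ t.2 - b.2) : m * w + 2 ≤ 2 * (S.card : ℤ) := by
  have h1 := hS.card_above ha hb ht hm
  have h2 := hS.card_below ha hb hbot hm
  have h3 : (m + 1).toNat ≤ (S.filter fun z => z.2 = a.2).card := by
    have hsub : (Finset.Ico 0 (m + 1)).image (fun k => (a.1 + k, a.2)) ⊆
        S.filter fun z => z.2 = a.2 := by
      intro z hz
      obtain ⟨k, hk, rfl⟩ := Finset.mem_image.1 hz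
      rw [Finset.mem_Ico] at hk
      refine Finset.mem_filter.2 ⟨hS.segment ha hb rfl hk.1 ?_, rfl⟩
      dsimp only
      linarith
    have := Finset.card_le_card hsub
    rwa [Finset.card_image_of_injective _ (fun k l hkl => by simpa using hkl), Int.card_Ico,
      sub_zero] at this
  have h4 : (S.filter fun z => a.2 < z.2).card + (S.filter fun z => z.2 < a.2).card +
      (S.filter fun z => z.2 = a.2).card ≤ S.card := by
    rw [← Finset.card_union_of_disjoint, ← Finset.card_union_of_disjoint]
    · refine Finset.card_le_card fun z hz => ?_
      simp only [Finset.mem_union, Finset.mem_filter] at hz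
      tauto
    · rw [Finset.disjoint_left]
      intro z hz hz'
      simp only [Finset.mem_union, Finset.mem_filter] at hz hz'
      omega
    · rw [Finset.disjoint_left]
      intro z hz hz'
      simp only [Finset.mem_filter] at hz hz'
      omega
  zify at h3 h4
  rw [Int.toNat_of_nonneg (by linarith)] at h3
  nlinarith [mul_le_mul_of_nonneg_left hw hm]

/-- A point of the unit interval moved with nonzero velocity `u` exits at a definite time. -/
theorem exists_exit_unitInterval {θ u : ℝ} (h0 : 0 ≤ θ) (h1 : θ ≤ 1) (hu : u ≠ 0) :
    ∃ τ : ℝ, 0 ≤ τ ∧ (θ + τ * u = 0 ∨ θ + τ * u = 1) ∧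
      ∀ r, 0 ≤ r → r ≤ τ → 0 ≤ θ + r * u ∧ θ + r * u ≤ 1 := by
  rcases hu.lt_or_gt with hu | hu
  · have hτ : θ / -u * u = -θ := by field_simp
    refine ⟨θ / -u, div_nonneg h0 (by linarith), Or.inl (by linarith), fun r hr hr' => ?_⟩
    constructor <;> nlinarith
  · have hτ : (1 - θ) / u * u = 1 - θ := by field_simp
    refine ⟨(1 - θ) / u, div_nonneg (by linarith) hu.le, Or.inr (by linarith), fun r hr hr' => ?_⟩
    constructor <;> nlinarith

/-- A point on the diagonal of the unit square can be moved in any direction to its boundary. -/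
theorem exists_exit_unitSquare {θ u v : ℝ} (h0 : 0 ≤ θ) (h1 : θ ≤ 1) (huv : u ≠ 0 ∨ v ≠ 0) :
    ∃ r : ℝ, 0 ≤ r ∧ (0 ≤ θ + r * u ∧ θ + r * u ≤ 1) ∧ (0 ≤ θ + r * v ∧ θ + r * v ≤ 1) ∧
      ((θ + r * u = 0 ∨ θ + r * u = 1) ∨ (θ + r * v = 0 ∨ θ + r * v = 1)) := by
  by_cases hu : u = 0
  · obtain ⟨τ, hτ, he, hb⟩ := exists_exit_unitInterval h0 h1 (huv.resolve_left (not_not.2 hu))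
    exact ⟨τ, hτ, by simp [hu, h0, h1], hb τ hτ le_rfl, Or.inr he⟩
  by_cases hv : v = 0
  · obtain ⟨τ, hτ, he, hb⟩ := exists_exit_unitInterval h0 h1 hu
    exact ⟨τ, hτ, hb τ hτ le_rfl, by simp [hv, h0, h1], Or.inl he⟩
  obtain ⟨τ, hτ, he, hb⟩ := exists_exit_unitInterval h0 h1 hu
  obtain ⟨τ', hτ', he', hb'⟩ := exists_exit_unitInterval h0 h1 hv
  rcases le_total τ τ' with h | h
  · exact ⟨τ, hτ, hb τ hτ le_rfl, hb' τ hτ h, Or.inl he⟩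
  · exact ⟨τ', hτ', hb τ' hτ' h, hb' τ' hτ' le_rfl, Or.inr he'⟩

theorem TriClosed.mem_toward {S : Finset (ℤ × ℤ)} (hS : TriClosed S) {p q₁ q₂ : ℤ × ℤ} {k : ℤ}
    {μ κ : ℝ} (hp : p ∈ S) (hq₁ : q₁ ∈ S) (hq₂ : q₂ ∈ S) (hμ0 : 0 ≤ μ) (hμ1 : μ ≤ 1) (hκ0 : 0 ≤ κ)
    (hκ1 : κ ≤ 1) (hy : (p.2 : ℝ) = q₁.2 + μ * (q₂.2 - q₁.2))
    (hx : (k : ℝ) = κ * (q₁.1 + μ * (q₂.1 - q₁.1) - p.1)) : (p.1 + k, p.2) ∈ S := by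
  refine hS p hp q₁ hq₁ q₂ hq₂ _ (1 - κ) (κ * (1 - μ)) (κ * μ) (by linarith)
    (mul_nonneg hκ0 (by linarith)) (mul_nonneg hκ0 hμ0) (by ring) ?_ ?_
  · push_cast
    rw [hx]
    ring
  · dsimp only
    linear_combination κ * hy

/-- If the segment joining two differences of points of `S` meets the horizontal axis at
abscissa at least `m`, then `S` has two points at horizontal distance exactly `m`. -/
theorem TriClosed.exists_horizontal {S : Finset (ℤ × ℤ)} (hS : TriClosed S)
    {a₁ b₁ a₂ b₂ : ℤ × ℤ} {m : ℤ} (ha₁ : a₁ ∈ S) (hb₁ : b₁ ∈ S) (ha₂ : a₂ ∈ S) (hb₂ : b₂ ∈ S)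
    (hm : 0 ≤ m) (h₁ : a₁.2 ≤ b₁.2) (h₂ : b₂.2 < a₂.2)
    (h : m * ((a₂.2 - b₂.2) + (b₁.2 - a₁.2)) ≤
      (b₁.2 - a₁.2) * (a₂.1 - b₂.1) + (a₂.2 - b₂.2) * (a₁.1 - b₁.1)) :
    ∃ a ∈ S, (a.1 + m, a.2) ∈ S := by
  have hm' : (0 : ℝ) ≤ m := by exact_mod_cast hm
  have h₁' : (0 : ℝ) ≤ b₁.2 - a₁.2 := by exact_mod_cast sub_nonneg.2 h₁
  have h₂' : (0 : ℝ) < a₂.2 - b₂.2 := by exact_mod_cast sub_pos.2 h₂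
  have h' : (m : ℝ) * ((a₂.2 - b₂.2) + (b₁.2 - a₁.2)) ≤
      (b₁.2 - a₁.2) * (a₂.1 - b₂.1) + (a₂.2 - b₂.2) * (a₁.1 - b₁.1) := by exact_mod_cast h
  obtain ⟨θ, hθ⟩ : ∃ θ : ℝ, θ = (b₁.2 - a₁.2) / ((a₂.2 - b₂.2) + (b₁.2 - a₁.2)) := ⟨_, rfl⟩
  have hden : (0 : ℝ) < (a₂.2 - b₂.2) + (b₁.2 - a₁.2) := by linarith
  have hθ0 : 0 ≤ θ := hθ ▸ div_nonneg h₁' hden.le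
  have hθ1 : θ ≤ 1 := by
    rw [hθ, div_le_one hden]
    linarith
  have hθy : θ * ((a₂.2 - b₂.2) + (b₁.2 - a₁.2)) = b₁.2 - a₁.2 := by
    rw [hθ]
    field_simp
  have hθx : (m : ℝ) ≤ (1 - θ) * (a₁.1 - b₁.1) + θ * (a₂.1 - b₂.1) := by
    refine le_of_mul_le_mul_right ?_ hden
    refine h'.trans (le_of_eq ?_)
    linear_combination ((a₁.1 - b₁.1 : ℝ) - (a₂.1 - b₂.1)) * hθy
  obtain ⟨σ, hσ, hobj⟩ : ∃ σ : ℝ, σ ≠ 0 ∧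
      0 ≤ σ * ((b₂.2 - b₁.2) * (a₂.1 - a₁.1) - (a₂.2 - a₁.2) * (b₂.1 - b₁.1)) := by
    rcases le_total (0 : ℝ) ((b₂.2 - b₁.2) * (a₂.1 - a₁.1) - (a₂.2 - a₁.2) * (b₂.1 - b₁.1))
      with hs | hs
    · exact ⟨1, one_ne_zero, by linarith⟩
    · exact ⟨-1, by norm_num, by linarith⟩
  obtain ⟨r, hr, ⟨hl0, hl1⟩, ⟨hm0, hm1⟩, hexit⟩ := exists_exit_unitSquare
    (u := σ * (b₂.2 - b₁.2)) (v := σ * (a₂.2 - a₁.2)) hθ0 hθ1 (by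
      by_contra! hcon
      have e1 := (mul_eq_zero.1 hcon.1).resolve_left hσ
      have e2 := (mul_eq_zero.1 hcon.2).resolve_left hσ
      linarith)
  obtain ⟨l, hl⟩ : ∃ l : ℝ, l = θ + r * (σ * (b₂.2 - b₁.2)) := ⟨_, rfl⟩
  obtain ⟨μ, hμ⟩ : ∃ μ : ℝ, μ = θ + r * (σ * (a₂.2 - a₁.2)) := ⟨_, rfl⟩
  rw [← hl] at hl0 hl1 hexit
  rw [← hμ] at hm0 hm1 hexit
  have hy : (a₁.2 : ℝ) + l * (a₂.2 - a₁.2) = b₁.2 + μ * (b₂.2 - b₁.2) := by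
    rw [hl, hμ]
    linear_combination hθy
  have hx : (m : ℝ) ≤ (a₁.1 + l * (a₂.1 - a₁.1)) - (b₁.1 + μ * (b₂.1 - b₁.1)) := by
    rw [hl, hμ]
    linarith [mul_nonneg hr hobj]
  obtain ⟨κ, hκ0, hκ1, hκ⟩ : ∃ κ : ℝ, 0 ≤ κ ∧ κ ≤ 1 ∧
      (m : ℝ) = κ * ((a₁.1 + l * (a₂.1 - a₁.1)) - (b₁.1 + μ * (b₂.1 - b₁.1))) := by
    rcases hm'.eq_or_lt with h0 | h0
    · exact ⟨0, le_rfl, zero_le_one, by linarith⟩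
    · have hpos := h0.trans_le hx
      exact ⟨_, div_nonneg hm' hpos.le, (div_le_one hpos).2 hx, (div_mul_cancel₀ _ hpos.ne').symm⟩
  have fromA : ∀ a ∈ S, (a.1 : ℝ) = a₁.1 + l * (a₂.1 - a₁.1) →
      (a.2 : ℝ) = a₁.2 + l * (a₂.2 - a₁.2) → ∃ a ∈ S, (a.1 + m, a.2) ∈ S := by
    intro a ha e1 e2
    refine ⟨(a.1 + -m, a.2), hS.mem_toward ha hb₁ hb₂ hm0 hm1 hκ0 hκ1 (e2.trans hy) ?_, by simpa⟩
    push_cast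
    rw [e1]
    linarith
  have fromB : ∀ b ∈ S, (b.1 : ℝ) = b₁.1 + μ * (b₂.1 - b₁.1) →
      (b.2 : ℝ) = b₁.2 + μ * (b₂.2 - b₁.2) → ∃ a ∈ S, (a.1 + m, a.2) ∈ S := by
    intro b hb e1 e2
    refine ⟨b, hb, hS.mem_toward hb ha₁ ha₂ hl0 hl1 hκ0 hκ1 (e2.trans hy.symm) ?_⟩
    rw [e1]
    exact hκ
  rcases hexit with (e | e) | (e | e)
  · exact fromA a₁ ha₁ (by rw [e]; ring) (by rw [e]; ring)
  · exact fromA a₂ ha₂ (by rw [e]; ring) (by rw [e]; ring)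
  · exact fromB b₁ hb₁ (by rw [e]; ring) (by rw [e]; ring)
  · exact fromB b₂ hb₂ (by rw [e]; ring) (by rw [e]; ring)

/-- A set without two points at horizontal distance `m` lies strictly inside a strip of
horizontal width `m`. -/
theorem TriClosed.exists_slope {S : Finset (ℤ × ℤ)} (hS : TriClosed S) {m : ℤ} (hm : 0 ≤ m)
    (hno : ¬ ∃ a ∈ S, (a.1 + m, a.2) ∈ S) :
    ∃ s : ℝ, ∀ a ∈ S, ∀ b ∈ S, (a.1 - b.1 : ℝ) - s * (a.2 - b.2) < m := by
  obtain ⟨s, hlo, hhi⟩ := Order.exists_between_finsets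
    (lo := ((S ×ˢ S).filter fun z => z.2.2 < z.1.2).image fun z =>
      ((z.1.1 - z.2.1 - m : ℝ) / (z.1.2 - z.2.2)))
    (hi := ((S ×ˢ S).filter fun z => z.1.2 < z.2.2).image fun z =>
      ((m - (z.1.1 - z.2.1) : ℝ) / (z.2.2 - z.1.2))) (by
      intro x hx y hy
      obtain ⟨⟨a₂, b₂⟩, h2, rfl⟩ := Finset.mem_image.1 hx
      obtain ⟨⟨a₁, b₁⟩, h1, rfl⟩ := Finset.mem_image.1 hy
      simp only [Finset.mem_filter, Finset.mem_product] at h1 h2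
      by_contra! hcon
      refine hno (hS.exists_horizontal h1.1.1 h1.1.2 h2.1.1 h2.1.2 hm h1.2.le h2.2 ?_)
      rw [div_le_div_iff₀ (by exact_mod_cast sub_pos.2 h1.2)
        (by exact_mod_cast sub_pos.2 h2.2)] at hcon
      have hcon' : (m - (a₁.1 - b₁.1)) * (a₂.2 - b₂.2) ≤
        (a₂.1 - b₂.1 - m) * (b₁.2 - a₁.2) := by exact_mod_cast hcon
      linarith)
  refine ⟨s, fun a ha b hb => ?_⟩
  rcases lt_trichotomy b.2 a.2 with hlt | heq | hgt
  · have := hlo _ (Finset.mem_image_of_mem _ (Finset.mem_filter.2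
      ⟨Finset.mk_mem_product ha hb, hlt⟩))
    dsimp only at this
    rw [div_lt_iff₀ (by exact_mod_cast sub_pos.2 hlt)] at this
    linarith
  · have : a.1 - b.1 < m := by
      by_contra! hcon
      exact hno ⟨b, hb, hS.segment hb ha heq.symm hm hcon⟩
    have : (a.1 - b.1 : ℝ) < m := by exact_mod_cast this
    rw [heq]
    linarith
  · have := hhi _ (Finset.mem_image_of_mem _ (Finset.mem_filter.2
      ⟨Finset.mk_mem_product ha hb, hgt⟩))
    dsimp only at this
    rw [lt_div_iff₀ (by exact_mod_cast sub_pos.2 hgt)] at this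
    linarith

theorem slope_inequality {m w s α y x v : ℝ} (hm : 0 < m) (hw : 13 * m ≤ 8 * w)
    (hs1 : s ≤ 1 / 2) (hs0 : 0 ≤ s) (hα : 0 ≤ α) (hx : w ≤ x) (hv : v ≤ w) (hy : w - α ≤ y)
    (hP : x - s * v < m) (hQ : α + s * y < m) : m * (x + α) ≤ α * v + x * y := by
  have hwm : m < w := by linarith
  have hσ : w - m < s * w := by nlinarith
  have hw2 : w < 2 * m := by nlinarith
  have hα1 : α * (1 - s) < m - s * w := by nlinarith
  have hα2 : α < w := by nlinarith
  have hα3 : α * (w - s * w) < w * (m - s * w) := by nlinarith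
  have hα4 : α * m ≤ w * (2 * m - w) := by
    nlinarith [mul_nonneg (sub_nonneg.2 hσ.le) (sub_nonneg.2 hα2.le)]
  have hym : m ≤ y := by
    refine le_of_mul_le_mul_left ?_ hm
    nlinarith
  have hsv : w - m < s * v := by linarith
  have hv0 : 0 < v := by
    by_contra! hcon
    nlinarith
  have hv2 : 2 * (w - m) ≤ v := by nlinarith
  have hfin : 0 ≤ w * (w - m) - α * (3 * m - w) := by
    refine nonneg_of_mul_nonneg_right ?_ hm
    have hquad : 0 ≤ -w ^ 2 + 6 * m * w - 7 * m ^ 2 := by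
      nlinarith [mul_nonneg (sub_nonneg.2 hw) (sub_nonneg.2 hw2.le)]
    nlinarith [mul_le_mul_of_nonneg_right hα4 (by linarith : 0 ≤ 3 * m - w),
      mul_nonneg (by linarith : 0 ≤ w) hquad]
  nlinarith [mul_le_mul_of_nonneg_left hv2 hα,
    mul_nonneg (sub_nonneg.2 hx) (sub_nonneg.2 hym),
    mul_le_mul_of_nonneg_left hy (by linarith : 0 ≤ w)]

theorem TriClosed.exists_vertical {S : Finset (ℤ × ℤ)} (hS : TriClosed S) {m w : ℤ} {s : ℝ}
    (hw : WidthGE S w) (hy : ∀ a ∈ S, ∀ b ∈ S, a.2 - b.2 ≤ w) (hm : 0 < m) (hmw : 13 * m ≤ 8 * w)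
    (hs0 : 0 ≤ s) (hs1 : s ≤ 1 / 2)
    (hs : ∀ a ∈ S, ∀ b ∈ S, (a.1 - b.1 : ℝ) - s * (a.2 - b.2) < m) :
    ∃ a ∈ S, (a.1, a.2 + m) ∈ S := by
  obtain ⟨a, ha, b, hb, hab⟩ := hw (1, 0) (by simp)
  obtain ⟨c, hc, d, hd, hcd⟩ := hw (-1, 1) (by simp)
  dsimp only at hab hcd
  have hab2 := hy a ha b hb
  have hcd2 := hy c hc d hd
  have key : m * ((a.1 - b.1) + (d.1 - c.1)) ≤
      (d.1 - c.1) * (a.2 - b.2) + (a.1 - b.1) * (c.2 - d.2) := by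
    have hP := hs a ha b hb
    have hQ := hs d hd c hc
    have : (m : ℝ) * ((a.1 - b.1) + (d.1 - c.1)) ≤
        (d.1 - c.1) * (a.2 - b.2) + (a.1 - b.1) * (c.2 - d.2) := by
      refine slope_inequality (w := w) (s := s) (by exact_mod_cast hm) (by exact_mod_cast hmw)
        hs1 hs0 ?_ ?_ ?_ ?_ hP ?_
      · have : 0 ≤ d.1 - c.1 := by linarith
        exact_mod_cast this
      · have : w ≤ a.1 - b.1 := by linarith
        exact_mod_cast this
      · exact_mod_cast hab2
      · have : w - (d.1 - c.1) ≤ c.2 - d.2 := by linarith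
        exact_mod_cast this
      · linarith
    exact_mod_cast this
  obtain ⟨e, he, he'⟩ := (hS.preimage (p := 0) (q := 1) (r := 1) (t := 0)
    (by norm_num)).exists_horizontal (a₁ := (c.2, c.1)) (b₁ := (d.2, d.1)) (a₂ := (a.2, a.1))
    (b₂ := (b.2, b.1)) (m := m)
    (by rw [mem_unimodularPreimage]; simpa using hc)
    (by rw [mem_unimodularPreimage]; simpa using hd)
    (by rw [mem_unimodularPreimage]; simpa using ha)
    (by rw [mem_unimodularPreimage]; simpa using hb) hm.le
    (by dsimp only; linarith) (by dsimp only; linarith) key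
  rw [mem_unimodularPreimage] at he he'
  exact ⟨(e.2, e.1), by simpa using he, by simpa using he'⟩

theorem exists_round_sign (s : ℝ) :
    ∃ k ε : ℤ, ε * ε = 1 ∧ 0 ≤ (ε : ℝ) * (s - k) ∧ (ε : ℝ) * (s - k) ≤ 1 / 2 := by
  have h := abs_le.1 (abs_sub_round s)
  rcases le_total 0 (s - round s) with h0 | h0
  · exact ⟨round s, 1, by norm_num, by simpa using h0, by simpa using h.2⟩
  · exact ⟨round s, -1, by norm_num, by push_cast; linarith, by push_cast; linarith⟩

theorem TriClosed.mul_width_le_card {S : Finset (ℤ × ℤ)} (hS : TriClosed S) {m w : ℤ}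
    (hw : WidthGE S w) (hy : ∀ a ∈ S, ∀ b ∈ S, a.2 - b.2 ≤ w) (hm : 0 ≤ m)
    (hmw : 13 * m ≤ 8 * w) : m * w + 2 ≤ 2 * (S.card : ℤ) := by
  by_cases hex : ∃ a ∈ S, (a.1 + m, a.2) ∈ S
  · obtain ⟨a, ha, hb⟩ := hex
    obtain ⟨t, ht, b, hbot, htb⟩ := hw (0, 1) (by simp)
    exact hS.card_ge ha hb ht hbot hm (by simpa using htb)
  have hm' : 0 < m := by
    refine hm.lt_of_ne ?_
    rintro rfl
    obtain ⟨t, ht, -⟩ := hw (0, 1) (by simp)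
    exact hex ⟨t, ht, by simpa using ht⟩
  obtain ⟨s, hs⟩ := hS.exists_slope hm hex
  obtain ⟨k, ε, hε, hs0, hs1⟩ := exists_round_sign s
  have hdet : (1 * ε - k * ε * 0) * (1 * ε - k * ε * 0) = 1 := by linarith
  have hε' : (ε : ℝ) * ε = 1 := by exact_mod_cast hε
  obtain ⟨a, ha, hb⟩ := (hS.preimage hdet).exists_vertical (hw.preimage hdet) (m := m)
    (fun a ha b hb => by
      rw [mem_unimodularPreimage] at ha hb
      have h1 := hy _ ha _ hb
      have h2 := hy _ hb _ ha
      dsimp only at h1 h2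
      rcases mul_self_eq_one_iff.1 hε with rfl | rfl <;> linarith) hm' hmw hs0 hs1
    (fun a ha b hb => by
      rw [mem_unimodularPreimage] at ha hb
      have h1 := hs _ ha _ hb
      push_cast at h1
      refine lt_of_eq_of_lt ?_ h1
      ring)
  obtain ⟨t, ht, b, hbot, htb⟩ := (hw.preimage hdet) (1, 0) (by simp)
  rw [mem_unimodularPreimage] at ha hb ht hbot
  have hdet' : (k * ε * 0 - 1 * ε) * (k * ε * 0 - 1 * ε) = 1 := by linarith
  refine (hS.preimage hdet').card_ge (a := (a.2, a.1)) (t := (t.2, t.1)) (b := (b.2, b.1))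
    ?_ ?_ ?_ ?_ hm ?_ |>.trans_eq (by rw [card_unimodularPreimage])
  · rw [mem_unimodularPreimage]
    convert ha using 2 <;> ring
  · rw [mem_unimodularPreimage]
    convert hb using 2 <;> ring
  · rw [mem_unimodularPreimage]
    convert ht using 2 <;> ring
  · rw [mem_unimodularPreimage]
    convert hbot using 2 <;> ring
  · simpa using htb

theorem TriClosed.sq_le_four_card {S : Finset (ℤ × ℤ)} (hS : TriClosed S) {w : ℤ}
    (hw : WidthGE S w) (hy : ∀ a ∈ S, ∀ b ∈ S, a.2 - b.2 ≤ w) (hw0 : 0 ≤ w) :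
    w ^ 2 ≤ 4 * (S.card : ℤ) := by
  have h := hS.mul_width_le_card (m := 8 * w / 13) hw hy (by positivity) (by omega)
  have h13 : 8 * w - 12 ≤ 13 * (8 * w / 13) := by omega
  nlinarith [mul_le_mul_of_nonneg_right h13 hw0, sq_nonneg (w - 4)]

theorem DigitalConvex.triClosed {S : Finset (ℤ × ℤ)} (hS : DigitalConvex (S : Set (ℤ × ℤ))) :
    TriClosed S := by
  intro a ha b hb c hc p α β γ hα hβ hγ h1 hx hy
  have hmem : ∀ z ∈ S, toR2 z ∈ convexHull ℝ (toR2 '' (S : Set (ℤ × ℤ))) := fun z hz =>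
    subset_convexHull ℝ _ (Set.mem_image_of_mem _ hz)
  have hp : p ∈ {z : ℤ × ℤ | toR2 z ∈ convexHull ℝ (toR2 '' (S : Set (ℤ × ℤ)))} := by
    have := (convex_convexHull ℝ (toR2 '' (S : Set (ℤ × ℤ)))).sum_mem (t := Finset.univ)
      (w := ![α, β, γ]) (z := ![toR2 a, toR2 b, toR2 c])
      (by intro i _; fin_cases i <;> simpa) (by simpa [Fin.sum_univ_three] using h1)
      (by intro i _; fin_cases i <;> simp [hmem, ha, hb, hc])
    rw [Set.mem_ofPred_eq]
    convert this using 1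
    ext <;> simp [Fin.sum_univ_three, toR2, hx, hy]
  rw [hS] at hp
  exact hp

/-- The set of values `u · (b - a)` for `a, b ∈ S`. -/
def dotDifferences (S : Finset (ℤ × ℤ)) (u : ℤ × ℤ) : Set ℤ :=
  {d : ℤ | ∃ a ∈ (S : Set (ℤ × ℤ)), ∃ b ∈ (S : Set (ℤ × ℤ)),
    d = u.1 * (b.1 - a.1) + u.2 * (b.2 - a.2)}

theorem dotDifferences_bddAbove (S : Finset (ℤ × ℤ)) (u : ℤ × ℤ) :
    BddAbove (dotDifferences S u) := by
  refine (((S ×ˢ S).image fun z : (ℤ × ℤ) × ℤ × ℤ =>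
    u.1 * (z.2.1 - z.1.1) + u.2 * (z.2.2 - z.1.2)).finite_toSet.subset ?_).bddAbove
  rintro d ⟨a, ha, b, hb, rfl⟩
  exact Finset.mem_coe.2 (Finset.mem_image.2 ⟨(a, b), Finset.mk_mem_product ha hb, rfl⟩)

theorem zero_mem_dotDifferences {S : Finset (ℤ × ℤ)} (hne : S.Nonempty) (u : ℤ × ℤ) :
    0 ∈ dotDifferences S u := by
  obtain ⟨a, ha⟩ := hne
  exact ⟨a, ha, a, ha, by ring⟩

theorem latticeWidth_spec {S : Finset (ℤ × ℤ)} (hne : S.Nonempty) :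
    0 ≤ latticeWidth S ∧ WidthGE S (latticeWidth S) ∧
      ∃ u : ℤ × ℤ, u ≠ 0 ∧ ∀ a ∈ S, ∀ b ∈ S,
        u.1 * (b.1 - a.1) + u.2 * (b.2 - a.2) ≤ latticeWidth S := by
  have hnn : ∀ u, 0 ≤ sSup (dotDifferences S u) := fun u =>
    le_csSup (dotDifferences_bddAbove S u) (zero_mem_dotDifferences hne u)
  have hbdd : BddBelow {w : ℤ | ∃ u : ℤ × ℤ, u ≠ 0 ∧ w = sSup (dotDifferences S u)} := by
    refine ⟨0, ?_⟩
    rintro w ⟨u, -, rfl⟩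
    exact hnn u
  obtain ⟨u, hu, hmin⟩ : latticeWidth S ∈
      {w : ℤ | ∃ u : ℤ × ℤ, u ≠ 0 ∧ w = sSup (dotDifferences S u)} :=
    Int.csInf_mem ⟨_, (1, 0), by simp, rfl⟩ hbdd
  refine ⟨hmin ▸ hnn u, fun v hv => ?_, u, hu, fun a ha b hb => ?_⟩
  · obtain ⟨a, ha, b, hb, hab⟩ := Int.csSup_mem ⟨0, zero_mem_dotDifferences hne v⟩
      (dotDifferences_bddAbove S v)
    exact ⟨b, hb, a, ha, (csInf_le hbdd ⟨v, hv, rfl⟩).trans hab.le⟩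
  · rw [hmin]
    exact le_csSup (dotDifferences_bddAbove S u) ⟨a, ha, b, hb, rfl⟩

/-- A functional realising a positive lattice width is primitive. -/
theorem WidthGE.isCoprime {S : Finset (ℤ × ℤ)} {w : ℤ} (hS : WidthGE S w) (hw : 0 < w)
    {u : ℤ × ℤ} (hu : u ≠ 0)
    (hmax : ∀ a ∈ S, ∀ b ∈ S, u.1 * (b.1 - a.1) + u.2 * (b.2 - a.2) ≤ w) :
    IsCoprime u.1 u.2 := by
  have hg : 0 < Int.gcd u.1 u.2 := by
    rw [Int.gcd_pos_iff]
    by_contra! hcon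
    exact hu (Prod.ext hcon.1 hcon.2)
  obtain ⟨c, d, hcd, h1, h2⟩ := Int.exists_gcd_one hg
  obtain ⟨a, ha, b, hb, hab⟩ := hS (c, d) (by
    rintro h0
    rw [Prod.mk_eq_zero] at h0
    simp [h0] at hcd)
  have hba := hmax b hb a ha
  have hg1 : (Int.gcd u.1 u.2 : ℤ) ≤ 1 := by
    by_contra! hcon
    have hle : (c * (a.1 - b.1) + d * (a.2 - b.2)) * (Int.gcd u.1 u.2 : ℤ) ≤ w := by
      refine le_of_eq_of_le ?_ hba
      linear_combination -(a.1 - b.1) * h1 - (a.2 - b.2) * h2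
    dsimp only at hab
    nlinarith
  rw [Int.isCoprime_iff_gcd_eq_one]
  omega

theorem discrete_blaschke_lebesgue_simple
    (S : Set (ℤ × ℤ)) (hfin : S.Finite) (hne : S.Nonempty)
    (hdc : DigitalConvex S) :
    ((S.ncard : ℚ)) ≥ 1 / 4 * (latticeWidth S : ℚ) ^ 2 := by
  lift S to Finset (ℤ × ℤ) using hfin
  obtain ⟨hw0, hw, u, hu, hmax⟩ := latticeWidth_spec (Finset.coe_nonempty.1 hne)
  have key : latticeWidth (S : Set (ℤ × ℤ)) ^ 2 ≤ 4 * (S.card : ℤ) := by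
    rcases hw0.eq_or_lt with h0 | hpos
    · rw [← h0]
      positivity
    obtain ⟨x, y, hxy⟩ := hw.isCoprime hpos hu hmax
    have hdet : (u.2 * y - x * -u.1) * (u.2 * y - x * -u.1) = 1 := by
      rw [show u.2 * y - x * -u.1 = 1 by linarith, one_mul]
    rw [← card_unimodularPreimage hdet]
    refine (hdc.triClosed.preimage hdet).sq_le_four_card (hw.preimage hdet) ?_ hw0
    intro a ha b hb
    rw [mem_unimodularPreimage] at ha hb
    refine le_of_eq_of_le ?_ (hmax _ hb _ ha)
    dsimp only
    linear_combination -(a.2 - b.2) * hxy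
  have key' : (latticeWidth (S : Set (ℤ × ℤ)) : ℚ) ^ 2 ≤ 4 * (S.card : ℚ) := by
    exact_mod_cast key
  rw [Set.ncard_coe_finset]
  linarith
end
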